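/- Let H = (V, E) be a hypergraph whose associated bipartite graph bip H is connected. Then the set Q_H of hypertrees of H is convex as a set of lattice points: Q_H equals the intersection of ℤ^E (embedded in ℝ^E via coordinatewise coercion) with the convex hull in ℝ^E of Q_H. -/

import Mathlib

open SimpleGraph

/-- The bipartite graph associated to a hypergraph with hyperedge set `E`,
vertex set `V`, and incidence function `I`. -/
def bip {V E : Type*} (I : E → Finset V) : SimpleGraph (E ⊕ V) :=
  SimpleGraph.fromRel fun a b =>
    ∃ e v, a = Sum.inl e ∧ b = Sum.inr v ∧ v ∈ I e

/-- `f : E → ℕ` is a hypertree: there is a spanning tree of `bip I` whose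
degree at each `e ∈ E` is `f e + 1`. -/
def IsHypertree {V E : Type*} (I : E → Finset V) (f : E → ℕ) : Prop :=
  ∃ T : SimpleGraph (E ⊕ V), T ≤ bip I ∧ T.IsTree ∧
    ∀ e : E, (T.neighborSet (Sum.inl e)).ncard = f e + 1

/-- The set of hypertrees `Q_H`, viewed in `ℝ^E`. -/
def hypertreeSetR {V E : Type*} (I : E → Finset V) : Set (E → ℝ) :=
  {h | ∃ f : E → ℕ, IsHypertree I f ∧ h = fun e => (f e : ℝ)}

theorem bip_adj_inl_inr {V E : Type*} {I : E → Finset V} {e : E} {v : V} :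
    (bip I).Adj (Sum.inl e) (Sum.inr v) ↔ v ∈ I e := by
  simp [bip]

theorem bip_mono {V E : Type*} {A B : E → Finset V} (h : ∀ e, A e ⊆ B e) : bip A ≤ bip B := by
  rintro a b ⟨hab, H⟩
  refine ⟨hab, H.imp ?_ ?_⟩ <;>
  · rintro ⟨e, v, rfl, rfl, hv⟩
    exact ⟨e, v, rfl, rfl, h e hv⟩

theorem ncard_neighborSet_bip {V E : Type*} (A : E → Finset V) (e : E) :
    ((bip A).neighborSet (Sum.inl e)).ncard = (A e).card := by
  have h : (bip A).neighborSet (Sum.inl e) = Sum.inr '' (A e : Set V) := by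
    ext (x | x) <;> simp [bip]
  rw [h, Set.ncard_image_of_injective _ Sum.inr_injective, Set.ncard_coe_finset]

theorem card_edgeSet_bip {V E : Type*} [Fintype E] (A : E → Finset V) :
    Nat.card (bip A).edgeSet = ∑ e, (A e).card := by
  have hbij : Function.Bijective
      (fun x : Σ e, A e => (⟨s(Sum.inl x.1, Sum.inr x.2.1), bip_adj_inl_inr.2 x.2.2⟩ :
        (bip A).edgeSet)) := by
    constructor
    · rintro ⟨e, v, hv⟩ ⟨e', v', hv'⟩ h
      obtain ⟨rfl, rfl⟩ : e = e' ∧ v = v' := by simpa using congrArg Subtype.val h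
      rfl
    · rintro ⟨x, hx⟩
      induction x using Sym2.ind with
      | _ a b =>
        obtain ⟨e, v, rfl, rfl, hv⟩ | ⟨e, v, rfl, rfl, hv⟩ :=
          ((fromRel_adj _ a b).1 (show (bip A).Adj a b from hx)).2
        · exact ⟨⟨e, v, hv⟩, rfl⟩
        · exact ⟨⟨e, v, hv⟩, Subtype.ext Sym2.eq_swap⟩
  rw [← Nat.card_eq_of_bijective _ hbij]
  simp [Nat.card_eq_fintype_card]

/-- Hypertrees in terms of the neighborhoods of the hyperedges in the spanning tree. -/
theorem isHypertree_iff_exists_neighborhoods {V E : Type*} [Fintype V] {I : E → Finset V}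
    {f : E → ℕ} :
    IsHypertree I f ↔ ∃ A : E → Finset V,
      (∀ e, A e ⊆ I e) ∧ (bip A).IsTree ∧ ∀ e, (A e).card = f e + 1 := by
  classical
  constructor
  · rintro ⟨T, hle, hT, hf⟩
    let A : E → Finset V := fun e => {v | T.Adj (Sum.inl e) (Sum.inr v)}
    have hA : bip A = T := by
      ext (e | v) (e' | v')
      · have := fun h => @hle (Sum.inl e) (Sum.inl e') h
        simp_all [bip]
      · simp [bip, A]
      · simp [bip, A, T.adj_comm]
      · have := fun h => @hle (Sum.inr v) (Sum.inr v') h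
        simp_all [bip]
    refine ⟨A, fun e v hv => bip_adj_inl_inr.1 (hle ?_), hA ▸ hT, fun e => ?_⟩
    · simpa [A] using hv
    · rw [← ncard_neighborSet_bip, hA, hf]
  · rintro ⟨A, hle, hT, hf⟩
    exact ⟨bip A, bip_mono hle, hT, fun e => by rw [ncard_neighborSet_bip, hf]⟩

theorem SimpleGraph.IsAcyclic.card_edgeSet_lt {W : Type*} [Finite W] [Nonempty W]
    {G : SimpleGraph W} (hG : G.IsAcyclic) : Nat.card G.edgeSet < Nat.card W := by
  obtain ⟨T, hGT, -, hT⟩ := (connected_top (V := W)).exists_isTree_le_of_le_of_isAcyclic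
    (le_top : G ≤ ⊤) hG
  have h := (isTree_iff_connected_and_card.1 hT).2
  have : Nat.card G.edgeSet ≤ Nat.card T.edgeSet :=
    Nat.card_mono (Set.toFinite _) (edgeSet_mono hGT)
  omega

theorem IsHypertree.sum_add_one_eq {V E : Type*} [Fintype V] [Fintype E] {I : E → Finset V}
    {f : E → ℕ} (hf : IsHypertree I f) : ∑ e, f e + 1 = Fintype.card V := by
  obtain ⟨A, -, hT, hA⟩ := isHypertree_iff_exists_neighborhoods.1 hf
  have h := (isTree_iff_connected_and_card.1 hT).2
  rw [card_edgeSet_bip] at h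
  simp only [hA, Finset.sum_add_distrib, Nat.card_eq_fintype_card, Fintype.card_sum,
    Finset.sum_const, Finset.card_univ, smul_eq_mul, mul_one] at h
  omega

theorem IsHypertree.sum_lt_card_biUnion {V E : Type*} [Fintype V] [DecidableEq V]
    {I : E → Finset V} {f : E → ℕ} (hf : IsHypertree I f) {S : Finset E} (hS : S.Nonempty) :
    ∑ e ∈ S, f e < (S.biUnion I).card := by
  obtain ⟨A, hAI, hT, hA⟩ := isHypertree_iff_exists_neighborhoods.1 hf
  let B : S → Finset (S.biUnion I) := fun e => (A e).subtype (· ∈ S.biUnion I)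
  have hB : ∀ e : S, (B e).card = f e + 1 := fun e => by
    rw [← hA, Finset.card_subtype, Finset.filter_true_of_mem]
    exact fun v hv => Finset.mem_biUnion.2 ⟨e, e.2, hAI _ hv⟩
  let φ : S ⊕ S.biUnion I → E ⊕ V := Sum.map Subtype.val Subtype.val
  have hφ : Function.Injective φ := Subtype.val_injective.sumMap Subtype.val_injective
  have hBA : (bip A).comap φ = bip B := by
    ext (e | v) (e' | v') <;> simp [bip, B, φ, -Finset.mem_biUnion]
  have hBac : (bip B).IsAcyclic := hBA ▸ hT.isAcyclic.of_comap ⟨φ, hφ⟩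
  have : Nonempty (S ⊕ S.biUnion I) := ⟨Sum.inl ⟨_, hS.choose_spec⟩⟩
  have h := hBac.card_edgeSet_lt
  rw [card_edgeSet_bip] at h
  simp only [hB, Finset.sum_add_distrib, Nat.card_eq_fintype_card, Fintype.card_sum,
    Finset.sum_const, Finset.card_univ, smul_eq_mul, mul_one, Fintype.card_coe] at h
  rw [Finset.sum_coe_sort S f] at h
  omega

/-- Hall's theorem, with the hyperedge `e` to be matched with `f e` vertices. -/
theorem exists_injective_sigma_fin {V E : Type*} [Finite E] [DecidableEq V] {J : E → Finset V}
    {f : E → ℕ} (h : ∀ S : Finset E, ∑ e ∈ S, f e ≤ (S.biUnion J).card) :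
    ∃ m : (Σ e, Fin (f e)) → V, Function.Injective m ∧ ∀ x, m x ∈ J x.1 := by
  classical
  refine (Finset.all_card_le_biUnion_card_iff_exists_injective
    fun x : Σ e, Fin (f e) => J x.1).1 fun s => ?_
  calc s.card ≤ ((s.image Sigma.fst).sigma fun _ => Finset.univ).card :=
        Finset.card_le_card fun x hx => by
          simpa using ⟨x.2, hx⟩
    _ = ∑ e ∈ s.image Sigma.fst, f e := by simp
    _ ≤ ((s.image Sigma.fst).biUnion J).card := h _
    _ = (s.biUnion fun x => J x.1).card := by rw [Finset.image_biUnion]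

theorem isHypertree_of_sum_lt_card_biUnion {V E : Type*} [Fintype V] [Fintype E] [DecidableEq V]
    {I : E → Finset V} {f : E → ℕ} (hsum : ∑ e, f e + 1 = Fintype.card V)
    (hlt : ∀ S : Finset E, S.Nonempty → ∑ e ∈ S, f e < (S.biUnion I).card) :
    IsHypertree I f := by
  classical
  obtain ⟨r⟩ : Nonempty V := Fintype.card_pos_iff.1 (by omega)
  obtain ⟨m, hm, hmI⟩ : ∃ m : (Σ e, Fin (f e)) → V,
      Function.Injective m ∧ ∀ x, m x ∈ (I x.1).erase r := by
    refine exists_injective_sigma_fin (J := fun e => (I e).erase r) fun S => ?_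
    obtain rfl | hS := S.eq_empty_or_nonempty
    · simp
    have : (S.biUnion fun e => (I e).erase r) = (S.biUnion I).erase r := by
      ext; simp; tauto
    rw [this]
    have := hlt S hS
    have := Finset.pred_card_le_card_erase (s := S.biUnion I) (a := r)
    omega
  let M : E → Finset V := fun e => Finset.univ.image fun i => m ⟨e, i⟩
  have hM : ∀ e, (M e).card = f e := fun e => by
    have hinj : Function.Injective fun i => m ⟨e, i⟩ := hm.comp sigma_mk_injective
    rw [Finset.card_image_of_injective _ hinj, Finset.card_fin]
  have hMI : ∀ e, M e ⊆ I e := fun e v hv => by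
    obtain ⟨i, -, rfl⟩ := Finset.mem_image.1 hv
    exact Finset.mem_of_mem_erase (hmI ⟨e, i⟩)
  have hMcover : ∀ v, v ≠ r → ∃ e, v ∈ M e := fun v hv => by
    have himg : Finset.univ.image m = Finset.univ.erase r := by
      refine Finset.eq_of_subset_of_card_le (fun v hv => ?_) ?_
      · obtain ⟨x, -, rfl⟩ := Finset.mem_image.1 hv
        exact Finset.mem_erase.2 ⟨Finset.ne_of_mem_erase (hmI x), Finset.mem_univ _⟩
      · rw [Finset.card_image_of_injective _ hm, Finset.card_erase_of_mem (Finset.mem_univ _)]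
        simp only [Finset.card_univ, Fintype.card_sigma, Fintype.card_fin]
        omega
    obtain ⟨x, -, rfl⟩ := Finset.mem_image.1
      (himg.symm ▸ Finset.mem_erase.2 ⟨hv, Finset.mem_univ v⟩ : v ∈ Finset.univ.image m)
    exact ⟨x.1, Finset.mem_image.2 ⟨x.2, Finset.mem_univ _, rfl⟩⟩
  -- `R` consists of the hyperedges already joined to the root `r`.
  let Good : Finset E → Prop := fun R => ∃ A : E → Finset V, (∀ e, A e ⊆ I e) ∧
    (∀ e ∉ R, A e = ∅) ∧ ∀ e ∈ R, M e ⊆ A e ∧ (A e).card ≤ f e + 1 ∧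
      (bip A).Reachable (Sum.inl e) (Sum.inr r)
  obtain ⟨R, hR⟩ := (Set.toFinite {R | Good R}).exists_maximal
    ⟨∅, fun _ => ∅, by simp, by simp, by simp⟩
  obtain ⟨A, hAI, hA0, hA⟩ : Good R := hR.prop
  have hreach : ∀ v, (v = r ∨ ∃ e ∈ R, v ∈ M e) → (bip A).Reachable (Sum.inr v) (Sum.inr r) := by
    rintro v (rfl | ⟨e, he, hv⟩)
    · rfl
    · exact (bip_adj_inl_inr.2 ((hA e he).1 hv)).reachable.symm.trans (hA e he).2.2
  have hRuniv : R = Finset.univ := by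
    by_contra hne
    have hne' : Rᶜ.Nonempty := by simpa [Finset.nonempty_iff_ne_empty] using hne
    obtain ⟨e, heR, v, hv, hvR⟩ :
        ∃ e ∉ R, ∃ v ∈ I e, v = r ∨ ∃ e' ∈ R, v ∈ M e' := by
      by_contra! hcon
      refine (hlt _ hne').not_ge ?_
      calc (Rᶜ.biUnion I).card ≤ (Rᶜ.biUnion M).card := Finset.card_le_card fun v hv => by
            obtain ⟨e, he, hve⟩ := Finset.mem_biUnion.1 hv
            obtain ⟨hvr, hvR⟩ := hcon e (by simpa using he) v hve
            obtain ⟨e', he'⟩ := hMcover v hvr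
            exact Finset.mem_biUnion.2
              ⟨e', Finset.mem_compl.2 fun h => hvR e' h he', he'⟩
        _ ≤ ∑ e ∈ Rᶜ, (M e).card := Finset.card_biUnion_le
        _ = ∑ e ∈ Rᶜ, f e := by simp only [hM]
    let A' := Function.update A e (insert v (M e))
    have hAe : A' e = insert v (M e) := Function.update_self ..
    have hAne : ∀ e' ≠ e, A' e' = A e' := fun e' h => Function.update_of_ne h ..
    have hmono : bip A ≤ bip A' := bip_mono fun e' => by
      obtain rfl | h := eq_or_ne e' e
      · simp [hA0 _ heR]
      · rw [hAne _ h]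
    have hgood : Good (insert e R) := by
      refine ⟨A', fun e' => ?_, fun e' he' => ?_, fun e' he' => ?_⟩
      · obtain rfl | h := eq_or_ne e' e
        · rw [hAe]; exact Finset.insert_subset hv (hMI _)
        · rw [hAne _ h]; exact hAI _
      · rw [Finset.mem_insert, not_or] at he'
        rw [hAne _ he'.1, hA0 _ he'.2]
      · obtain rfl | h := eq_or_ne e' e
        · rw [hAe]
          refine ⟨Finset.subset_insert .., hM e' ▸ Finset.card_insert_le .., ?_⟩
          exact (bip_adj_inl_inr.2 (hAe ▸ Finset.mem_insert_self ..)).reachable.trans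
            ((hreach v hvR).mono hmono)
        · rw [hAne _ h]
          obtain ⟨h1, h2, h3⟩ := hA e' (Finset.mem_of_mem_insert_of_ne he' h)
          exact ⟨h1, h2, h3.mono hmono⟩
    exact heR (hR.le_of_ge hgood (Finset.subset_insert ..) (Finset.mem_insert_self ..))
  subst hRuniv
  have hconn : (bip A).Connected := by
    refine (connected_iff_exists_forall_reachable _).2 ⟨Sum.inr r, ?_⟩
    rintro (e | v)
    · exact (hA e (Finset.mem_univ e)).2.2.symm
    · refine (hreach v ?_).symm
      obtain h | h := eq_or_ne v r
      · exact Or.inl h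
      · obtain ⟨e, he⟩ := hMcover v h
        exact Or.inr ⟨e, Finset.mem_univ e, he⟩
  have hedges := hconn.card_vert_le_card_edgeSet_add_one
  have hle : ∀ e ∈ Finset.univ, (A e).card ≤ f e + 1 := fun e he => (hA e he).2.1
  have hsum' : ∑ e, (f e + 1) + 1 = Fintype.card E + Fintype.card V := by
    simp only [Finset.sum_add_distrib, Finset.sum_const, Finset.card_univ, smul_eq_mul, mul_one]
    omega
  rw [card_edgeSet_bip] at hedges
  simp only [Nat.card_eq_fintype_card, Fintype.card_sum] at hedges
  have hsumle := Finset.sum_le_sum hle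
  refine isHypertree_iff_exists_neighborhoods.2 ⟨A, hAI, ?_, fun e => ?_⟩
  · refine isTree_iff_connected_and_card.2 ⟨hconn, ?_⟩
    rw [card_edgeSet_bip]
    simp only [Nat.card_eq_fintype_card, Fintype.card_sum]
    omega
  · exact (Finset.sum_eq_sum_iff_of_le hle).1 (by omega) e (Finset.mem_univ e)

theorem isHypertree_iff_sum_lt_card_biUnion {V E : Type*} [Fintype V] [Fintype E] [DecidableEq V]
    {I : E → Finset V} {f : E → ℕ} :
    IsHypertree I f ↔ ∑ e, f e + 1 = Fintype.card V ∧
      ∀ S : Finset E, S.Nonempty → ∑ e ∈ S, f e < (S.biUnion I).card :=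
  ⟨fun h => ⟨h.sum_add_one_eq, fun _ hS => h.sum_lt_card_biUnion hS⟩,
    fun h => isHypertree_of_sum_lt_card_biUnion h.1 h.2⟩

/-- The polytope cut out by the inequalities characterizing hypertrees. -/
def hypertreePolytope {V E : Type*} [Fintype V] [Fintype E] [DecidableEq V]
    (I : E → Finset V) : Set (E → ℝ) :=
  {h | (∀ e, 0 ≤ h e) ∧ ∑ e, h e + 1 = Fintype.card V ∧
    ∀ S : Finset E, S.Nonempty → ∑ e ∈ S, h e + 1 ≤ (S.biUnion I).card}

theorem convex_hypertreePolytope {V E : Type*} [Fintype V] [Fintype E] [DecidableEq V]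
    (I : E → Finset V) : Convex ℝ (hypertreePolytope I) := by
  rintro x ⟨hx0, hx1, hx2⟩ y ⟨hy0, hy1, hy2⟩ a b ha hb hab
  have hsum : ∀ S : Finset E, ∑ e ∈ S, (a • x + b • y) e + 1
      = a * (∑ e ∈ S, x e + 1) + b * (∑ e ∈ S, y e + 1) := fun S => by
    simp only [Pi.add_apply, Pi.smul_apply, smul_eq_mul, Finset.sum_add_distrib, ← Finset.mul_sum]
    linear_combination -hab
  refine ⟨fun e => ?_, ?_, fun S hS => ?_⟩
  · have := mul_nonneg ha (hx0 e)
    have := mul_nonneg hb (hy0 e)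
    simp only [Pi.add_apply, Pi.smul_apply, smul_eq_mul]
    positivity
  · rw [hsum, hx1, hy1, ← add_mul, hab, one_mul]
  · rw [hsum]
    calc _ ≤ a * ((S.biUnion I).card : ℝ) + b * (S.biUnion I).card := by
          gcongr
          exacts [hx2 S hS, hy2 S hS]
      _ = _ := by rw [← add_mul, hab, one_mul]

theorem natCast_mem_hypertreePolytope_iff {V E : Type*} [Fintype V] [Fintype E] [DecidableEq V]
    {I : E → Finset V} {f : E → ℕ} :
    (fun e => (f e : ℝ)) ∈ hypertreePolytope I ↔ IsHypertree I f := by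
  rw [isHypertree_iff_sum_lt_card_biUnion]
  simp only [hypertreePolytope, Set.mem_ofPred_eq, Nat.cast_nonneg, implies_true, true_and,
    ← Nat.succ_le_iff, Nat.succ_eq_add_one]
  norm_cast

/-- The set of hypertrees is convex as a set of lattice points: it equals the
intersection of `ℤ^E` (embedded in `ℝ^E`) with its own convex hull. -/
theorem hypertreeSet_convex {V E : Type*} [Fintype V] [Fintype E]
    (I : E → Finset V) (hne : ∀ e, (I e).Nonempty)
    (hconn : (bip I).Connected) :
    hypertreeSetR I =
      Set.range (fun (g : E → ℤ) (e : E) => (g e : ℝ)) ∩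
        convexHull ℝ (hypertreeSetR I) := by
  classical
  apply Set.Subset.antisymm
  · rintro _ hh
    refine ⟨?_, subset_convexHull ℝ _ hh⟩
    obtain ⟨f, -, rfl⟩ := hh
    exact ⟨fun e => f e, by simp⟩
  · rintro _ ⟨⟨g, rfl⟩, hg⟩
    have hsub : hypertreeSetR I ⊆ hypertreePolytope I := by
      rintro _ ⟨f, hf, rfl⟩
      exact natCast_mem_hypertreePolytope_iff.2 hf
    have hgP := convexHull_min hsub (convex_hypertreePolytope I) hg
    lift g to E → ℕ using fun e => Int.cast_nonneg_iff.1 (hgP.1 e)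
    simp only [Int.cast_natCast] at hgP ⊢
    exact ⟨g, natCast_mem_hypertreePolytope_iff.1 hgP, rfl⟩
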